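/- Let U ⊆ ℝ be an open connected neighbourhood of a point a ∈ ℝ and let f : U → ℝ be a real-analytic function, not identically zero, with f(a) = 0. Let P ∈ ℝ[x, y] be an irreducible polynomial in two variables such that P(x, f(x)) = 0 for all x ∈ U, and let d = deg P. Then the order of vanishing of f at a is at most d; that is, there exists a natural number m with 1 ≤ m ≤ d such that the m-th derivative f^(m)(a) ≠ 0. -/

import Mathlib

/-- The analytic order of a nonzero real polynomial at a point is at most its degree. -/
theorem Polynomial.analyticOrderAt_eval_le_natDegree {p : Polynomial ℝ} (hp : p ≠ 0) (a : ℝ) :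
    analyticOrderAt (fun x ↦ p.eval x) a ≤ p.natDegree := by
  have iteratedDeriv_eval (i : ℕ) :
      iteratedDeriv i (fun x ↦ p.eval x) = fun x ↦ (Polynomial.derivative^[i] p).eval x := by
    induction i with
    | zero => simp
    | succ i ih =>
      rw [iteratedDeriv_succ, ih, Function.iterate_succ_apply']
      ext x
      simp
  by_contra! h
  have hana : AnalyticAt ℝ (fun x ↦ p.eval x) a := by
    simpa [Polynomial.coe_aeval_eq_eval] using
      (analyticAt_id (𝕜 := ℝ) (z := a)).aeval_polynomial p
  have h' : ((p.natDegree + 1 : ℕ) : ℕ∞) ≤ analyticOrderAt (fun x ↦ p.eval x) a := by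
    push_cast
    exact Order.add_one_le_of_lt h
  rw [natCast_le_analyticOrderAt_iff_iteratedDeriv_eq_zero hana] at h'
  have hlt : p.natDegree < p.rootMultiplicity a := by
    refine (Polynomial.lt_rootMultiplicity_iff_isRoot_iterate_derivative hp).2 fun m hm ↦ ?_
    simpa [iteratedDeriv_eval] using h' m (by omega)
  rw [← Polynomial.count_roots] at hlt
  exact hlt.not_ge ((Multiset.count_le_card _ _).trans p.card_roots')

/-- A bivariate polynomial is congruent to its restriction to `y = 0` modulo `y`. -/
theorem MvPolynomial.exists_eq_aeval_restrict_add_X_one_mul {R : Type*} [CommRing R]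
    (P : MvPolynomial (Fin 2) R) :
    ∃ Q : MvPolynomial (Fin 2) R,
      P = Polynomial.aeval (X 0) (aeval ![(Polynomial.X : Polynomial R), 0] P) + X 1 * Q := by
  induction P using MvPolynomial.induction_on with
  | C c => exact ⟨0, by simp [← MvPolynomial.algebraMap_eq]⟩
  | add p q hp hq =>
    obtain ⟨A, hA⟩ := hp
    obtain ⟨B, hB⟩ := hq
    refine ⟨A + B, ?_⟩
    rw [map_add, map_add]
    linear_combination hA + hB
  | mul_X p i hp =>
    obtain ⟨A, hA⟩ := hp
    fin_cases i
    · refine ⟨A * X 0, ?_⟩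
      simp only [Fin.zero_eta, map_mul, aeval_X, Matrix.cons_val_zero, Polynomial.aeval_X]
      linear_combination X 0 * hA
    · exact ⟨p, by simp [mul_comm]⟩

theorem stmt_3 (U : Set ℝ) (hUopen : IsOpen U) (hUconn : IsConnected U)
    (a : ℝ) (haU : a ∈ U) (f : ℝ → ℝ) (hf : AnalyticOnNhd ℝ f U)
    (hfne : ∃ x ∈ U, f x ≠ 0) (hfa : f a = 0)
    (P : MvPolynomial (Fin 2) ℝ) (hPirr : Irreducible P)
    (hPf : ∀ x ∈ U, MvPolynomial.eval ![x, f x] P = 0)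
    (d : ℕ) (hd : d = P.totalDegree) :
    ∃ m : ℕ, 1 ≤ m ∧ m ≤ d ∧ iteratedDeriv m f a ≠ 0 := by
  obtain ⟨Q, hQ⟩ := P.exists_eq_aeval_restrict_add_X_one_mul
  set p : Polynomial ℝ := MvPolynomial.aeval ![Polynomial.X, 0] P with hp
  have hp0 : p ≠ 0 := by
    intro h0
    rw [h0, map_zero, zero_add] at hQ
    obtain ⟨x, hxU, hx⟩ := hfne
    rcases hPirr.isUnit_or_isUnit hQ with h | h
    · simpa using h.map (MvPolynomial.eval (0 : Fin 2 → ℝ))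
    · have hPx := hPf x hxU
      rw [hQ, map_mul] at hPx
      exact mul_ne_zero (by simpa using hx) (h.map (MvPolynomial.eval ![x, f x])).ne_zero hPx
  have hpdeg : p.natDegree ≤ d := by
    have := MvPolynomial.aeval_natDegree_le P hd.ge ![Polynomial.X, 0] (n := 1)
      (by intro i; fin_cases i <;> simp)
    simpa using this
  by_contra! hder
  have hfan : AnalyticAt ℝ f a := hf a haU
  have hford : ((d + 1 : ℕ) : ℕ∞) ≤ analyticOrderAt f a := by
    rw [natCast_le_analyticOrderAt_iff_iteratedDeriv_eq_zero hfan]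
    intro i hi
    rcases Nat.eq_zero_or_pos i with rfl | hi0
    · simpa using hfa
    · exact hder i hi0 (by omega)
  have hQan : AnalyticAt ℝ (fun x ↦ -MvPolynomial.eval ![x, f x] Q) a := by
    refine AnalyticAt.neg ?_
    have := AnalyticAt.aeval_mvPolynomial (𝕜 := ℝ) (f := fun x ↦ ![x, f x]) (z := a)
      (fun i ↦ by fin_cases i <;> simp <;> fun_prop) Q
    simpa [MvPolynomial.aeval_eq_eval] using this
  have hpeq : (fun x ↦ p.eval x) =ᶠ[nhds a] f * fun x ↦ -MvPolynomial.eval ![x, f x] Q := by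
    filter_upwards [hUopen.mem_nhds haU] with x hx
    have hPx := hPf x hx
    have hcomp : MvPolynomial.eval ![x, f x] (Polynomial.aeval (MvPolynomial.X 0) p) =
        p.eval x := by
      rw [← MvPolynomial.coe_aeval_eq_eval, RingHom.coe_coe, ← Polynomial.aeval_algHom_apply]
      simp [Polynomial.coe_aeval_eq_eval]
    rw [hQ, map_add, hcomp, map_mul, MvPolynomial.eval_X] at hPx
    simp only [Matrix.cons_val_one, Matrix.cons_val_fin_one] at hPx
    simp only [Pi.mul_apply]
    linear_combination hPx
  have hle : ((d + 1 : ℕ) : ℕ∞) ≤ (d : ℕ∞) :=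
    calc ((d + 1 : ℕ) : ℕ∞) ≤ analyticOrderAt f a := hford
      _ ≤ analyticOrderAt (fun x ↦ p.eval x) a := by
        rw [analyticOrderAt_congr hpeq, analyticOrderAt_mul hfan hQan]
        exact le_self_add
      _ ≤ p.natDegree := p.analyticOrderAt_eval_le_natDegree hp0 a
      _ ≤ d := by exact_mod_cast hpdeg
  have : d + 1 ≤ d := by exact_mod_cast hle
  omega
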